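/- Fix integers n ≥ 1 and k ≥ 1. The entries of the consistency matrix π_{n,k} are given, for arbitrary multigraphs G and H each with n edges and no isolated vertices, by π_{n,k}([G],[H]) = (1/|Aut(H)|) · Σ_{ψ : H ↠ G} ∏_{v ∈ V(G)} k(k−1)⋯(k − |ψ⁻¹(v)| + 1), where the sum runs over all surjective node-and-edge homomorphisms ψ from H onto G, ψ⁻¹(v) is the preimage of v under the vertex map of ψ, and Aut(H) is the group of node-and-edge automorphisms of H. -/

import Mathlib

open MeasureTheory Filter Set Topology
open scoped BigOperators Classical ENNReal

noncomputable section

/-- The type of kernels: functions `[0,1]² → ℝ` (formalized as functions on all of `ℝ²`). -/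
abbrev Kern : Type := ℝ → ℝ → ℝ

/-- Lebesgue measure restricted to `[0,1]`. -/
abbrev μ01 : Measure ℝ := volume.restrict (Set.Icc 0 1)

/-- Symmetric measurable function. -/
def IsSymmMeas (f : Kern) : Prop :=
  Measurable (Function.uncurry f) ∧ ∀ x y, f x y = f y x

/-- Membership in the space `𝒲` of bounded symmetric measurable functions. -/
def IsKernel (f : Kern) : Prop := IsSymmMeas f ∧ ∃ C : ℝ, ∀ x y, |f x y| ≤ C

/-- A graphon: a symmetric measurable function with values in `[0,1]`. -/
def IsGraphon (f : Kern) : Prop := IsSymmMeas f ∧ ∀ x y, f x y ∈ Set.Icc (0:ℝ) 1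

/-- The set `W` of graphons. -/
def Graphons : Set Kern := {f | IsGraphon f}

/-- A multigraph (no loops, multiple edges allowed), with vertex set `Fin nv` and
edge (multi)set indexed by `Fin ne`, the edge `e` having endpoints `s e`, `t e`. -/
structure MG where
  nv : ℕ
  ne : ℕ
  s : Fin ne → Fin nv
  t : Fin ne → Fin nv
  noLoop : ∀ e, s e ≠ t e

/-- The homomorphism density `t(G, f)` of a multigraph `G` in a kernel `f`. -/
def homDensity (G : MG) (f : Kern) : ℝ :=
  ∫ x : Fin G.nv → ℝ, ∏ e : Fin G.ne, f (x (G.s e)) (x (G.t e))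
    ∂(Measure.pi fun _ => μ01)

/-- A node-and-edge homomorphism of multigraphs. -/
structure MGHom (G H : MG) where
  vMap : Fin G.nv → Fin H.nv
  eMap : Fin G.ne → Fin H.ne
  compat : ∀ e, ({H.s (eMap e), H.t (eMap e)} : Finset (Fin H.nv))
      = {vMap (G.s e), vMap (G.t e)}

/-- A surjective node-and-edge homomorphism. -/
def MGHom.Surj {G H : MG} (φ : MGHom G H) : Prop :=
  Function.Surjective φ.vMap ∧ Function.Surjective φ.eMap

/-- A bijective node-and-edge homomorphism. -/
def MGHom.Bij {G H : MG} (φ : MGHom G H) : Prop :=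
  Function.Bijective φ.vMap ∧ Function.Bijective φ.eMap

instance (G H : MG) : Finite (MGHom G H) := by
  have hinj : Function.Injective (fun φ : MGHom G H => (φ.vMap, φ.eMap)) := by
    rintro ⟨v1, e1, h1⟩ ⟨v2, e2, h2⟩ h
    simp only [Prod.mk.injEq] at h
    obtain ⟨hv, he⟩ := h
    subst hv; subst he; rfl
  exact Finite.of_injective _ hinj

/-- Isomorphism of multigraphs. -/
def MGIso (G H : MG) : Prop := ∃ φ : MGHom G H, φ.Bij

/-- A multigraph with no isolated vertices. -/
def NoIsolated (G : MG) : Prop := ∀ v, ∃ e, G.s e = v ∨ G.t e = v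

/-- A multigraph is simple if no two (distinct) edges have the same pair of endpoints. -/
def IsSimpleMG (G : MG) : Prop :=
  ∀ e e', ({G.s e, G.t e} : Finset (Fin G.nv)) = ({G.s e', G.t e'} : Finset (Fin G.nv))
    → e = e'

/-- A class function on graphon space: it only depends on the homomorphism densities
with respect to finite simple graphs. -/
def IsClassFun (F : Kern → ℝ) : Prop :=
  ∀ f g, IsGraphon f → IsGraphon g →
    (∀ G : MG, IsSimpleMG G → homDensity G f = homDensity G g) → F f = F g

/-- The `L¹` distance between two kernels (on the square `[0,1]²`). -/
def l1Dist (f g : Kern) : ℝ := ∫ x, ∫ y, |f x y - g x y| ∂μ01 ∂μ01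

/-- Continuity on the set of graphons with respect to the `L¹` norm. -/
def L1ContOn (F : Kern → ℝ) : Prop :=
  ∀ f ∈ Graphons, ∀ ε : ℝ, 0 < ε → ∃ δ : ℝ, 0 < δ ∧
    ∀ g ∈ Graphons, l1Dist f g < δ → |F f - F g| < ε

/-- The cut norm of a kernel. -/
def cutNorm (f : Kern) : ℝ :=
  sSup {r : ℝ | ∃ S T : Set ℝ, MeasurableSet S ∧ MeasurableSet T ∧
    S ⊆ Set.Icc 0 1 ∧ T ⊆ Set.Icc 0 1 ∧ r = |∫ x in S, ∫ y in T, f x y|}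

/-- Continuity on the set of graphons with respect to the cut norm. -/
def CutContOn (F : Kern → ℝ) : Prop :=
  ∀ f ∈ Graphons, ∀ ε : ℝ, 0 < ε → ∃ δ : ℝ, 0 < δ ∧
    ∀ g ∈ Graphons, cutNorm (f - g) < δ → |F f - F g| < ε

section Gateaux

variable {E : Type*} [AddCommGroup E] [Module ℝ E]

/-- Admissible directions at `f` for a convex subset `U` of a real vector space:
directions `g` so that `f + ε g ∈ U` for all sufficiently small `ε ∈ [0,1)`. -/
def adm (U : Set E) (f : E) : Set E :=
  {g | ∃ ε₀ : ℝ, 0 < ε₀ ∧ ε₀ ≤ 1 ∧ ∀ ε : ℝ, 0 ≤ ε → ε < ε₀ → f + ε • g ∈ U}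

/-- Iterated mixed Gâteaux derivative `d^n F(f; g₁, …, g_n)` of `F : U → ℝ`, computed
through one-sided difference quotients restricted to `U`; the derivative in the last
direction is taken first.  (The value is given by `Filter.limUnder`, i.e. it is the
limit of the difference quotients whenever this limit exists.) -/
def gD (U : Set E) (F : E → ℝ) : (n : ℕ) → E → (Fin n → E) → ℝ
  | 0 => fun f _ => F f
  | n + 1 => fun f g =>
      limUnder (nhdsWithin (0:ℝ) {t : ℝ | t ≠ 0 ∧ f + t • g (Fin.last n) ∈ U})
        (fun t => (gD U F n (f + t • g (Fin.last n)) (fun i => g i.castSucc)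
              - gD U F n f (fun i => g i.castSucc)) / t)

/-- `F` is `n` times Gâteaux differentiable on `U`: all iterated Gâteaux derivatives
up to order `n` in admissible directions exist (i.e. the corresponding difference
quotients genuinely converge). -/
def GDiffN (U : Set E) (F : E → ℝ) : ℕ → Prop
  | 0 => True
  | n + 1 => GDiffN U F n ∧
      ∀ f ∈ U, ∀ g : Fin (n+1) → E, (∀ i, g i ∈ adm U f) →
        Tendsto
          (fun t : ℝ => (gD U F n (f + t • g (Fin.last n)) (fun i => g i.castSucc)
              - gD U F n f (fun i => g i.castSucc)) / t)
          (nhdsWithin (0:ℝ) {t : ℝ | t ≠ 0 ∧ f + t • g (Fin.last n) ∈ U})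
          (nhds (gD U F (n+1) f g))

/-- `F : U → ℝ` is `C^n` at `f`: for any admissible directions `g₁, …, g_m`, the map
`(λ₁, …, λ_m) ↦ F(f + Σᵢ λᵢ gᵢ)` admits a `C^n` extension to all of `ℝ^m`. -/
def IsCnAt (U : Set E) (F : E → ℝ) (n : ℕ) (f : E) : Prop :=
  ∀ (m : ℕ) (g : Fin m → E), (∀ i, g i ∈ adm U f) →
    ∃ G : (Fin m → ℝ) → ℝ, ContDiff ℝ n G ∧
      ∀ lam : Fin m → ℝ, f + ∑ i, lam i • g i ∈ U → G lam = F (f + ∑ i, lam i • g i)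

/-- `F` is `C^n` (everywhere on `U`). -/
def IsCn (U : Set E) (F : E → ℝ) (n : ℕ) : Prop := ∀ f ∈ U, IsCnAt U F n f

/-- `F` is Gâteaux smooth: `C^n` at every point for every `n`. -/
def GSmooth (U : Set E) (F : E → ℝ) : Prop := ∀ n : ℕ, IsCn U F n

end Gateaux

/-- Iso-invariance of a family of constants indexed by multigraphs. -/
def IsoInvariant (a : MG → ℝ) : Prop := ∀ G H, MGIso G H → a G = a H

/-- Coefficients indexed by the isomorphism classes of multigraphs with at most `N`
edges and no isolated vertices (encoded as iso-invariant families of constants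
vanishing outside this class of multigraphs). -/
def GoodCoeffs (N : ℕ) (a : MG → ℝ) : Prop :=
  IsoInvariant a ∧ ∀ G : MG, ¬(G.ne ≤ N ∧ NoIsolated G) → a G = 0

/-- A functional on `W^n` is multilinear if its restriction to tuples from the
subspace `𝒲` (= span of `W`) is linear in each coordinate. -/
def MultilinearOnKerns (n : ℕ) (Λ : (Fin n → Kern) → ℝ) : Prop :=
  (∀ (g : Fin n → Kern), (∀ j, IsKernel (g j)) → ∀ (i : Fin n) (u v : Kern),
      IsKernel u → IsKernel v →
      Λ (Function.update g i (u + v))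
        = Λ (Function.update g i u) + Λ (Function.update g i v)) ∧
  (∀ (g : Fin n → Kern), (∀ j, IsKernel (g j)) → ∀ (i : Fin n) (c : ℝ) (u : Kern),
      IsKernel u →
      Λ (Function.update g i (c • u)) = c * Λ (Function.update g i u))

/-- A functional on `W^n` extends to a multilinear functional on `(span ℝ W)^n`. -/
def IsMultilinearOnW (n : ℕ) (Λ : (Fin n → Kern) → ℝ) : Prop :=
  ∃ L : MultilinearMap ℝ (fun _ : Fin n => ↥(Submodule.span ℝ Graphons)) ℝ,
    ∀ (g : Fin n → Kern) (h : ∀ i, g i ∈ Graphons),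
      L (fun i => ⟨g i, Submodule.subset_span (h i)⟩) = Λ g

/-- An invertible Lebesgue-measure-preserving bijection of `[0,1]`. -/
def IsMPB (σ : ℝ → ℝ) : Prop :=
  MeasurePreserving σ μ01 μ01 ∧ Set.BijOn σ (Set.Icc 0 1) (Set.Icc 0 1)

/-- The action `f ↦ f^σ` of maps of `[0,1]` on kernels. -/
def Kern.translate (σ : ℝ → ℝ) (f : Kern) : Kern := fun x y => f (σ x) (σ y)

/-- The cell `((a)/p, (a+1)/p]` of the regular partition of `[0,1]` (`a = 0, …, p-1`). -/
def cell (p : ℕ) (a : Fin p) : Set ℝ :=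
  Set.Ioc (((a : ℕ) : ℝ) / (p : ℝ)) ((((a : ℕ) : ℝ) + 1) / (p : ℝ))

/-- The basic step graphon `e^p_(a,b)`: symmetrized indicator of `cell a × cell b`. -/
def ep (p : ℕ) (a b : Fin p) : Kern := fun x y =>
  if (x ∈ cell p a ∧ y ∈ cell p b) ∨ (x ∈ cell p b ∧ y ∈ cell p a) then 1 else 0

/-- The step kernel with values `c a b` on the cell `cell a × cell b` (`a ≠ b`) and `0`
on the diagonal cells and outside `(0,1]²`. -/
def stepFn (p : ℕ) (c : Fin p → Fin p → ℝ) : Kern := fun x y =>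
  ∑ a : Fin p, ∑ b : Fin p, if a ≠ b ∧ x ∈ cell p a ∧ y ∈ cell p b then c a b else 0

/-- The set `W_𝐩 = ⋃ₚ W_p` of step graphons. -/
def StepGraphons : Set Kern := {f | IsGraphon f ∧ ∃ p c, f = stepFn p c}

/-- The union of the `S_[0,1]`-translates of `W_𝐩`. -/
def StepTranslates : Set Kern :=
  {f | ∃ σ : ℝ → ℝ, IsMPB σ ∧ ∃ g ∈ StepGraphons, f = Kern.translate σ g}

/-- Add `m` isolated vertices to a multigraph. -/
def MG.pad (G : MG) (m : ℕ) : MG where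
  nv := G.nv + m
  ne := G.ne
  s := fun e => Fin.castAdd m (G.s e)
  t := fun e => Fin.castAdd m (G.t e)
  noLoop := fun e h => G.noLoop e (by
    apply Fin.ext
    simpa using congrArg Fin.val h)

/-- Two multigraphs become isomorphic after deleting isolated vertices (equivalently,
after adding enough isolated vertices). -/
def StripEquiv (G H : MG) : Prop := ∃ a b : ℕ, MGIso (G.pad a) (H.pad b)

/-- A tuple of pairs of distinct indices in `Fin p` (encoding a tuple in `E_p^n`). -/
def ValidTuple (p n : ℕ) (x : Fin n → Fin p × Fin p) : Prop := ∀ l, (x l).1 ≠ (x l).2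

/-- The multigraph `Γ_{n,p}(x)` associated to a tuple `x ∈ E_p^n`. -/
def tupleMG (p n : ℕ) (x : Fin n → Fin p × Fin p) (hx : ValidTuple p n x) : MG :=
  ⟨p, n, fun l => (x l).1, fun l => (x l).2, hx⟩

/-- Symmetry of a functional on `W^n` under permutation of arguments. -/
def SymmFunc (n : ℕ) (Λ : (Fin n → Kern) → ℝ) : Prop :=
  ∀ (g : Fin n → Kern), (∀ i, g i ∈ Graphons) → ∀ τ : Equiv.Perm (Fin n),
    Λ (g ∘ τ) = Λ g

/-- `S_[0,1]`-invariance of a functional on `W^n`. -/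
def SInvFunc (n : ℕ) (Λ : (Fin n → Kern) → ℝ) : Prop :=
  ∀ (g : Fin n → Kern), (∀ i, g i ∈ Graphons) → ∀ σ : ℝ → ℝ, IsMPB σ →
    Λ (fun i => Kern.translate σ (g i)) = Λ g

/-- `π` is the consistency-constraint matrix `π_{n,k}`: it is invariant under
isomorphism-after-deleting-isolated-vertices in both arguments, and for every `p ≥ 2`,
every symmetric `S_[0,1]`-invariant multilinear functional `Λ : W^n → ℝ`, every
`x ∈ E_p^n` and every complete system `y` of pairwise non-isomorphic representatives
of the multigraphs with `n` edges on `kp` vertices, one has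
`C_{n,p}(Λ)(Γ(x)) = Σ_h π(Γ(x)∼, h∼) C_{n,kp}(Λ)(h)`. -/
def ConsistencyMatrix (n k : ℕ) (π : MG → MG → ℕ) : Prop :=
  (∀ G G' H H', StripEquiv G G' → StripEquiv H H' → π G H = π G' H') ∧
  ∀ p : ℕ, 2 ≤ p → ∀ Λ : (Fin n → Kern) → ℝ,
    SymmFunc n Λ → SInvFunc n Λ → MultilinearOnKerns n Λ →
    ∀ (x : Fin n → Fin p × Fin p) (hx : ValidTuple p n x),
    ∀ (m : ℕ) (y : Fin m → Fin n → Fin (k*p) × Fin (k*p))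
      (hy : ∀ i, ValidTuple (k*p) n (y i)),
      (∀ i j, i ≠ j →
        ¬ MGIso (tupleMG (k*p) n (y i) (hy i)) (tupleMG (k*p) n (y j) (hy j))) →
      (∀ (z : Fin n → Fin (k*p) × Fin (k*p)) (hz : ValidTuple (k*p) n z),
        ∃ i, MGIso (tupleMG (k*p) n z hz) (tupleMG (k*p) n (y i) (hy i))) →
      Λ (fun l => ep p (x l).1 (x l).2)
        = ∑ i : Fin m,
            (π (tupleMG p n x hx) (tupleMG (k*p) n (y i) (hy i)) : ℝ)
              * Λ (fun l => ep (k*p) (y i l).1 (y i l).2)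

/-- Adjacency relation of a multigraph. -/
def MG.adj (G : MG) (u v : Fin G.nv) : Prop :=
  ∃ e, (G.s e = u ∧ G.t e = v) ∨ (G.s e = v ∧ G.t e = u)

/-- The homomorphism density of the simplification `G^simp` of a multigraph `G`
(replace each family of parallel edges by a single edge). -/
def simpHomDensity (G : MG) (f : Kern) : ℝ :=
  ∫ x : Fin G.nv → ℝ,
    ∏ q ∈ Finset.univ.filter (fun q : Fin G.nv × Fin G.nv => q.1 < q.2 ∧ G.adj q.1 q.2),
      f (x q.1) (x q.2) ∂(Measure.pi fun _ => μ01)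

/-- Tensor product of two kernels with respect to a fixed measure-preserving map
`φ : [0,1] → [0,1]²`. -/
def tensProd (φ : ℝ → ℝ × ℝ) (f g : Kern) : Kern :=
  fun x y => f (φ x).1 (φ y).1 * g (φ x).2 (φ y).2

/-- `m`-fold tensor power of a kernel. -/
def tensPow (φ : ℝ → ℝ × ℝ) (f : Kern) : ℕ → Kern
  | 0 => fun _ _ => 1
  | 1 => f
  | (m+2) => tensProd φ f (tensPow φ f (m+1))

/-- A complete system of representatives for the isomorphism classes of multigraphs
with no isolated vertices. -/
def IsRepSet (R : Set MG) : Prop :=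
  (∀ G ∈ R, NoIsolated G) ∧ ∀ G : MG, NoIsolated G → ∃! H, H ∈ R ∧ MGIso G H

/-- A `k`-labelled multigraph: a multigraph together with an injective labelling of `k`
distinguished vertices. -/
structure LMG (k : ℕ) where
  G : MG
  lab : Fin k → Fin G.nv
  inj : Function.Injective lab

/-- No unlabelled isolated vertices. -/
def LMG.NoUnlabIsolated {k : ℕ} (H : LMG k) : Prop :=
  ∀ v, (∃ e, H.G.s e = v ∨ H.G.t e = v) ∨ ∃ a, H.lab a = v

/-- Assignment of coordinates to the vertices of a `k`-labelled multigraph: labelled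
vertices get the fixed values `x`, unlabelled ones the integration variables `y`. -/
def LMG.assign {k : ℕ} (H : LMG k) (x : Fin k → ℝ) (y : Fin H.G.nv → ℝ) :
    Fin H.G.nv → ℝ :=
  fun v => if h : ∃ a, H.lab a = v then x h.choose else y v

/-- The partially labelled homomorphism density `t_𝐱(H, f)`. -/
def lhom {k : ℕ} (H : LMG k) (x : Fin k → ℝ) (f : Kern) : ℝ :=
  ∫ y : Fin H.G.nv → ℝ,
    ∏ e : Fin H.G.ne, f (H.assign x y (H.G.s e)) (H.assign x y (H.G.t e))
    ∂(Measure.pi fun _ => μ01)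

/-- The weighted partially labelled homomorphism density `t_𝐱(H, f; w)`. -/
def wlhom {k : ℕ} (H : LMG k) (x : Fin k → ℝ) (f : Kern)
    (w : (Fin H.G.nv → ℝ) → ℝ) : ℝ :=
  ∫ y : Fin H.G.nv → ℝ,
    w (H.assign x y) *
      ∏ e : Fin H.G.ne, f (H.assign x y (H.G.s e)) (H.assign x y (H.G.t e))
    ∂(Measure.pi fun _ => μ01)

/-- The seminorm `‖w‖_{1,𝐱} = t_𝐱(H, 1, |w|)` of a weight. -/
def wnorm {k : ℕ} (H : LMG k) (x : Fin k → ℝ) (w : (Fin H.G.nv → ℝ) → ℝ) : ℝ :=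
  ∫ y : Fin H.G.nv → ℝ, |w (H.assign x y)| ∂(Measure.pi fun _ => μ01)

/-- Label-respecting isomorphism of `k`-labelled multigraphs. -/
def LMGIso {k : ℕ} (H H' : LMG k) : Prop :=
  ∃ (φv : Fin H.G.nv ≃ Fin H'.G.nv) (φe : Fin H.G.ne ≃ Fin H'.G.ne),
    (∀ e, ({H'.G.s (φe e), H'.G.t (φe e)} : Finset (Fin H'.G.nv))
        = {φv (H.G.s e), φv (H.G.t e)}) ∧
    ∀ a, φv (H.lab a) = H'.lab a

/-- A complete system of representatives for the label-respecting isomorphism classes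
of `k`-labelled multigraphs with no unlabelled isolated vertices. -/
def IsLRepSet (k : ℕ) (R : Set (LMG k)) : Prop :=
  (∀ H ∈ R, H.NoUnlabIsolated) ∧
  ∀ H : LMG k, H.NoUnlabIsolated → ∃! H', H' ∈ R ∧ LMGIso H H'

end


/-! ### Combinatorics of multigraphs -/

theorem fpair_iff {α : Type*} [DecidableEq α] (a b c d : α) :
    ({a, b} : Finset α) = {c, d} ↔ (a = c ∧ b = d) ∨ (a = d ∧ b = c) := by
  rw [← Finset.coe_inj]
  push_cast
  exact Set.pair_eq_pair_iff

theorem MGHom.compat_iff {G H : MG} (φ : MGHom G H) (e : Fin G.ne) :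
    (H.s (φ.eMap e) = φ.vMap (G.s e) ∧ H.t (φ.eMap e) = φ.vMap (G.t e)) ∨
    (H.s (φ.eMap e) = φ.vMap (G.t e) ∧ H.t (φ.eMap e) = φ.vMap (G.s e)) :=
  (fpair_iff _ _ _ _).1 (φ.compat e)

theorem MGHom.ext' {G H : MG} {φ ψ : MGHom G H} (hv : φ.vMap = ψ.vMap)
    (he : φ.eMap = ψ.eMap) : φ = ψ := by
  cases φ; cases ψ; simp only at hv he; subst hv; subst he; rfl

def MGHom.comp' {G H K : MG} (ψ : MGHom H K) (φ : MGHom G H) : MGHom G K where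
  vMap := ψ.vMap ∘ φ.vMap
  eMap := ψ.eMap ∘ φ.eMap
  compat := by
    intro e
    rw [fpair_iff]
    have h1 := φ.compat_iff e
    have h2 := ψ.compat_iff (φ.eMap e)
    simp only [Function.comp]
    rcases h1 with ⟨h1, h1'⟩ | ⟨h1, h1'⟩ <;> rw [h1, h1'] at h2 <;> tauto

theorem MGIso.refl' (G : MG) : MGIso G G :=
  ⟨⟨id, id, fun _ => rfl⟩, Function.bijective_id, Function.bijective_id⟩

theorem MGIso.trans' {G H K : MG} (h1 : MGIso G H) (h2 : MGIso H K) : MGIso G K := by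
  obtain ⟨φ, a, b⟩ := h1
  obtain ⟨ψ, c, d⟩ := h2
  exact ⟨ψ.comp' φ, c.comp a, d.comp b⟩

theorem MGIso.symm' {G H : MG} (h1 : MGIso G H) : MGIso H G := by
  obtain ⟨φ, a, b⟩ := h1
  obtain ⟨g, g1, g2⟩ := Function.bijective_iff_has_inverse.1 a
  obtain ⟨f, f1, f2⟩ := Function.bijective_iff_has_inverse.1 b
  refine ⟨⟨g, f, ?_⟩, ?_, ?_⟩
  · intro e
    rw [fpair_iff]
    have h := φ.compat_iff (f e)
    rw [f2 e] at h
    rcases h with ⟨h, h'⟩ | ⟨h, h'⟩ <;> rw [h, h', g1, g1] <;> simp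
  · exact Function.bijective_iff_has_inverse.2 ⟨_, g2, g1⟩
  · exact Function.bijective_iff_has_inverse.2 ⟨_, f2, f1⟩

theorem MGIso.pad0 (G : MG) : MGIso G (G.pad 0) :=
  ⟨⟨Fin.castAdd 0, id, fun _ => rfl⟩, Function.bijective_id, Function.bijective_id⟩

/-- Non-isolated vertices. -/
def MG.supp (G : MG) : Finset (Fin G.nv) :=
  Finset.univ.filter fun v => ∃ e, G.s e = v ∨ G.t e = v

theorem MG.s_mem (G : MG) (e) : G.s e ∈ G.supp := by simp [MG.supp]; exact ⟨e, Or.inl rfl⟩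
theorem MG.t_mem (G : MG) (e) : G.t e ∈ G.supp := by simp [MG.supp]; exact ⟨e, Or.inr rfl⟩

theorem MGHom.iso_of_injOn {G H : MG} (φ : MGHom G H) (hb : Function.Bijective φ.eMap)
    (hi : Set.InjOn φ.vMap G.supp) (hn : G.nv = H.nv) : MGIso G H := by
  obtain ⟨g, hg⟩ := Finset.exists_equiv_extend_of_card_eq (α := Fin G.nv) (β := Fin H.nv)
    (t := Finset.univ) (by simp [hn]) (s := G.supp) (f := φ.vMap) (Finset.subset_univ _) hi
  refine ⟨⟨fun v => (g v).1, φ.eMap, ?_⟩, ⟨?_, ?_⟩, hb⟩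
  · intro e
    rw [hg _ (G.s_mem e), hg _ (G.t_mem e)]
    exact φ.compat e
  · intro a b h
    exact g.injective (Subtype.ext h)
  · intro b
    exact ⟨g.symm ⟨b, Finset.mem_univ _⟩, by simp⟩

theorem MGHom.supp_sub {G H : MG} (φ : MGHom G H) (hb : Function.Surjective φ.eMap) :
    H.supp ⊆ G.supp.image φ.vMap := by
  intro v hv
  simp only [MG.supp, Finset.mem_filter, Finset.mem_univ, true_and] at hv
  obtain ⟨e, he⟩ := hv
  obtain ⟨e, rfl⟩ := hb e
  rw [Finset.mem_image]
  have h1 := G.s_mem e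
  have h2 := G.t_mem e
  rcases φ.compat_iff e with ⟨h, h'⟩ | ⟨h, h'⟩ <;> rw [h, h'] at he <;>
    rcases he with he | he
  · exact ⟨_, h1, he⟩
  · exact ⟨_, h2, he⟩
  · exact ⟨_, h2, he⟩
  · exact ⟨_, h1, he⟩

theorem MGHom.iso_of_card {G H : MG} (φ : MGHom G H) (hb : Function.Bijective φ.eMap)
    (hn : G.nv = H.nv) (hc : G.supp.card ≤ H.supp.card) : MGIso G H := by
  refine φ.iso_of_injOn hb ?_ hn
  rw [← Finset.card_image_iff]
  exact le_antisymm Finset.card_image_le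
    (hc.trans (Finset.card_le_card (φ.supp_sub hb.2)))

/-- Embeddings. -/
def Emb (H K : MG) : Type :=
  {φ : MGHom H K // Function.Injective φ.vMap ∧ Function.Bijective φ.eMap}

instance (H K : MG) : Finite (Emb H K) := by unfold Emb; infer_instance

theorem emb_iff (H K : MG) (b : ℕ) (hb : H.nv + b = K.nv) :
    Nonempty (Emb H K) ↔ MGIso (H.pad b) K := by
  constructor
  · rintro ⟨φ, hi, hbij⟩
    let f : Fin (H.nv + b) → Fin K.nv :=
      Fin.addCases φ.vMap (fun i => Fin.cast hb (Fin.natAdd _ i))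
    have hf : ∀ u, f (Fin.castAdd b u) = φ.vMap u := fun u => by simp [f]
    let Φ : MGHom (H.pad b) K := ⟨f, φ.eMap, fun e => by
      have := φ.compat e
      simp only [MG.pad]
      rw [hf, hf]; exact this⟩
    refine Φ.iso_of_injOn hbij ?_ hb
    have hs : ∀ v ∈ (H.pad b).supp, ∃ u, v = Fin.castAdd b u := by
      intro v hv
      simp only [MG.supp, Finset.mem_filter, Finset.mem_univ, true_and] at hv
      obtain ⟨e, he | he⟩ := hv
      · exact ⟨H.s e, he.symm⟩
      · exact ⟨H.t e, he.symm⟩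
    intro v hv v' hv' h
    obtain ⟨u, rfl⟩ := hs v hv
    obtain ⟨u', rfl⟩ := hs v' hv'
    have : φ.vMap u = φ.vMap u' := by rw [← hf, ← hf]; exact h
    rw [hi this]
  · rintro ⟨φ, h1, h2⟩
    refine ⟨⟨fun u => φ.vMap (Fin.castAdd b u), φ.eMap, fun e => φ.compat e⟩, ?_, h2⟩
    intro u u' h
    exact Fin.castAdd_injective _ _ (h1.1 h)

theorem emb_card (H K : MG) (hH : NoIsolated H) (h : Nonempty (Emb H K)) :
    Nat.card (Emb H K) = Nat.card {φ : MGHom H H // φ.Bij} := by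
  obtain ⟨φ0, hi, hb⟩ := h
  symm
  let F : {φ : MGHom H H // φ.Bij} → Emb H K := fun α =>
    ⟨φ0.comp' α.1, hi.comp α.2.1.1, hb.comp α.2.2⟩
  refine Nat.card_eq_of_bijective F ⟨?_, ?_⟩
  · rintro ⟨α, ha⟩ ⟨β, hβ⟩ h
    have h' : φ0.comp' α = φ0.comp' β := congrArg Subtype.val h
    apply Subtype.ext
    apply MGHom.ext'
    · funext u
      exact hi (congrFun (congrArg MGHom.vMap h') u)
    · funext u
      exact hb.1 (congrFun (congrArg MGHom.eMap h') u)
  · rintro ⟨φ, hφ, hφb⟩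
    have hv : ∀ u, ∃ u', φ0.vMap u' = φ.vMap u := by
      intro u
      have hm : ∀ e, ∃ e', φ0.eMap e' = φ.eMap e := fun e => hb.2 _
      obtain ⟨e, he⟩ := hH u
      obtain ⟨e', he'⟩ := hm e
      have h1 := φ.compat_iff e
      have h2 := φ0.compat_iff e'
      rw [he'] at h2
      rcases he with rfl | rfl <;> rcases h1 with ⟨h1, h1'⟩ | ⟨h1, h1'⟩ <;>
        rcases h2 with ⟨h2, h2'⟩ | ⟨h2, h2'⟩ <;>
        first
          | exact ⟨_, h2.symm.trans h1⟩
          | exact ⟨_, h2'.symm.trans h1'⟩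
    have he : ∀ e, ∃ e', φ0.eMap e' = φ.eMap e := fun e => hb.2 _
    choose a ha using hv
    choose c hc using he
    have hai : Function.Injective a := by
      intro u u' h
      apply hφ
      rw [← ha, ← ha, h]
    have hci : Function.Injective c := by
      intro u u' h
      apply hφb.1
      rw [← hc, ← hc, h]
    refine ⟨⟨⟨a, c, ?_⟩, Finite.injective_iff_bijective.1 hai,
      Finite.injective_iff_bijective.1 hci⟩, ?_⟩
    · intro e
      rw [fpair_iff]
      have h1 := φ.compat_iff e
      have h2 := φ0.compat_iff (c e)
      rw [hc] at h2
      rw [← ha, ← ha] at h1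
      rcases h1 with ⟨h1, h1'⟩ | ⟨h1, h1'⟩ <;> rcases h2 with ⟨h2, h2'⟩ | ⟨h2, h2'⟩
      · exact Or.inl ⟨hi (h2.symm.trans h1), hi (h2'.symm.trans h1')⟩
      · exact Or.inr ⟨hi (h2'.symm.trans h1'), hi (h2.symm.trans h1)⟩
      · exact Or.inr ⟨hi (h2.symm.trans h1), hi (h2'.symm.trans h1')⟩
      · exact Or.inl ⟨hi (h2'.symm.trans h1'), hi (h2.symm.trans h1)⟩
    · apply Subtype.ext
      apply MGHom.ext'
      · funext u; exact ha u
      · funext u; exact hc u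

/-- Number of fibrewise injective maps. -/
theorem card_fib (a b k : ℕ) (ψ : Fin a → Fin b) :
    Nat.card {f : Fin a → Fin k // ∀ u u', ψ u = ψ u' → f u = f u' → u = u'}
      = ∏ v : Fin b, Nat.descFactorial k (Nat.card {u : Fin a // ψ u = v}) := by
  have e : {f : Fin a → Fin k // ∀ u u', ψ u = ψ u' → f u = f u' → u = u'} ≃
      ((v : Fin b) → ({u : Fin a // ψ u = v} ↪ Fin k)) :=
    { toFun := fun f v => ⟨fun u => f.1 u.1, fun u u' h =>
        Subtype.ext (f.2 _ _ (u.2.trans u'.2.symm) h)⟩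
      invFun := fun F => ⟨fun u => F (ψ u) ⟨u, rfl⟩, by
        intro u u' h h'
        have key : ∀ v (hv : ψ u' = v), F v ⟨u', hv⟩ = F (ψ u') ⟨u', rfl⟩ := by
          intro v hv; subst hv; rfl
        have h2 : F (ψ u) ⟨u, rfl⟩ = F (ψ u') ⟨u', rfl⟩ := h'
        rw [← key (ψ u) h.symm] at h2
        have := (F (ψ u)).injective h2
        exact congrArg Subtype.val this⟩
      left_inv := fun f => rfl
      right_inv := fun F => by
        funext v
        ext ⟨u, hu⟩
        subst hu
        rfl }
  rw [Nat.card_congr e, Nat.card_pi]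
  refine Finset.prod_congr rfl fun v _ => ?_
  rw [Nat.card_eq_fintype_card, Fintype.card_embedding_eq, Fintype.card_fin,
    Nat.card_eq_fintype_card]

/-- Refinement of a graph by a blow-up map `ι`. -/
def blow (G : MG) (k q : ℕ) (ι : Fin G.nv → Fin k → Fin q)
    (ε : Fin G.ne → Fin k × Fin k) : Fin G.ne → Fin q × Fin q :=
  fun l => (ι (G.s l) (ε l).1, ι (G.t l) (ε l).2)

theorem blow_valid (G : MG) (k q : ℕ) (ι : Fin G.nv → Fin k → Fin q)
    (hι : ∀ a i b j, ι a i = ι b j → a = b ∧ i = j) (ε : Fin G.ne → Fin k × Fin k) :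
    ValidTuple q G.ne (blow G k q ι ε) := fun l h => G.noLoop l (hι _ _ _ _ h).1

theorem count_main (G H : MG) (hne : H.ne = G.ne) (hGni : NoIsolated G) (hHni : NoIsolated H)
    (k q : ℕ) (ι : Fin G.nv → Fin k → Fin q)
    (hι : ∀ a i b j, ι a i = ι b j → a = b ∧ i = j) :
    Nat.card (Σ ε : Fin G.ne → Fin k × Fin k,
        Emb H (tupleMG q G.ne (blow G k q ι ε) (blow_valid G k q ι hι ε)))
     = Nat.card (Σ ψ : {φ : MGHom H G // φ.Surj},
        {f : Fin H.nv → Fin k // ∀ u u', ψ.1.vMap u = ψ.1.vMap u' → f u = f u' → u = u'}) := by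
  let A := (Σ ε : Fin G.ne → Fin k × Fin k,
        Emb H (tupleMG q G.ne (blow G k q ι ε) (blow_valid G k q ι hι ε)))
  let B := (Σ ψ : {φ : MGHom H G // φ.Surj},
        {f : Fin H.nv → Fin k // ∀ u u', ψ.1.vMap u = ψ.1.vMap u' → f u = f u' → u = u'})
  let FA : A → (Fin H.nv → Fin q) × (Fin H.ne → Fin G.ne) := fun t => (t.2.1.vMap, t.2.1.eMap)
  let FB : B → (Fin H.nv → Fin q) × (Fin H.ne → Fin G.ne) :=
    fun t => (fun u => ι (t.1.1.vMap u) (t.2.1 u), t.1.1.eMap)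
  have hA : Function.Injective FA := by
    rintro ⟨ε, φ, h1, h2⟩ ⟨ε', φ', h1', h2'⟩ h
    have hv : φ.vMap = φ'.vMap := congrArg Prod.fst h
    have he : φ.eMap = φ'.eMap := congrArg Prod.snd h
    have hε : ε = ε' := by
      funext l
      obtain ⟨e, rfl⟩ := h2.2 l
      have c1 := φ.compat_iff e
      have c2 := φ'.compat_iff e
      rw [← hv, ← he] at c2
      simp only [tupleMG, blow] at c1 c2
      have hs := G.noLoop (φ.eMap e)
      rcases c1 with ⟨c1, c1'⟩ | ⟨c1, c1'⟩ <;> rcases c2 with ⟨c2, c2'⟩ | ⟨c2, c2'⟩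
      · exact Prod.ext (hι _ _ _ _ (c1.trans c2.symm)).2 (hι _ _ _ _ (c1'.trans c2'.symm)).2
      · exact absurd (hι _ _ _ _ (c1.trans c2'.symm)).1 hs
      · exact absurd (hι _ _ _ _ (c1.trans c2'.symm)).1 hs
      · exact Prod.ext (hι _ _ _ _ (c1.trans c2.symm)).2 (hι _ _ _ _ (c1'.trans c2'.symm)).2
    subst hε
    have : φ = φ' := MGHom.ext' hv he
    subst this
    rfl
  have hB : Function.Injective FB := by
    rintro ⟨⟨ψ, hψ⟩, f, hf⟩ ⟨⟨ψ', hψ'⟩, f', hf'⟩ h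
    simp only [FB, Prod.mk.injEq] at h
    obtain ⟨hv, he⟩ := h
    have h1 : ψ = ψ' := MGHom.ext' (funext fun u => (hι _ _ _ _ (congrFun hv u)).1) he
    subst h1
    have h2 : f = f' := funext fun u => (hι _ _ _ _ (congrFun hv u)).2
    subst h2
    rfl
  have hR : Set.range FA = Set.range FB := by
    apply Set.Subset.antisymm
    · rintro _ ⟨⟨ε, φ, h1, h2⟩, rfl⟩
      have hex : ∀ u, ∃ a i, ι a i = φ.vMap u := by
        intro u
        obtain ⟨e, he⟩ := hHni u
        have c := φ.compat_iff e
        simp only [tupleMG, blow] at c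
        rcases he with rfl | rfl <;> rcases c with ⟨c, c'⟩ | ⟨c, c'⟩ <;>
          first
            | exact ⟨_, _, c⟩
            | exact ⟨_, _, c'⟩
      choose a i hai using hex
      let ψ : MGHom H G := ⟨a, φ.eMap, by
        intro e
        rw [fpair_iff]
        have c := φ.compat_iff e
        rw [← hai, ← hai] at c
        simp only [tupleMG, blow] at c
        rcases c with ⟨c, c'⟩ | ⟨c, c'⟩
        · exact Or.inl ⟨(hι _ _ _ _ c).1, (hι _ _ _ _ c').1⟩
        · exact Or.inr ⟨(hι _ _ _ _ c).1, (hι _ _ _ _ c').1⟩⟩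
      have hψ : ψ.Surj := by
        refine ⟨?_, h2.2⟩
        intro v
        obtain ⟨e, he⟩ := hGni v
        obtain ⟨e, rfl⟩ := h2.2 e
        have c : _ ∨ _ := ψ.compat_iff e
        change ((G.s (φ.eMap e)) = _ ∧ G.t (φ.eMap e) = _) ∨
          ((G.s (φ.eMap e)) = _ ∧ G.t (φ.eMap e) = _) at c
        rcases he with rfl | rfl <;> rcases c with ⟨c, c'⟩ | ⟨c, c'⟩ <;>
          first
            | exact ⟨_, c.symm⟩
            | exact ⟨_, c'.symm⟩
      refine ⟨⟨⟨ψ, hψ⟩, i, ?_⟩, ?_⟩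
      · intro u u' h h'
        apply h1
        rw [← hai, ← hai, h']
        change a u = a u' at h
        rw [h]
      · exact Prod.ext (funext hai) rfl
    · rintro _ ⟨⟨⟨ψ, hψ⟩, f, hf⟩, rfl⟩
      have hbij : Function.Bijective ψ.eMap :=
        (Fintype.bijective_iff_surjective_and_card _).2 ⟨hψ.2, by simp [hne]⟩
      have hex : ∀ l, ∃ ij : Fin k × Fin k, ∀ e, ψ.eMap e = l →
          ({ι (G.s l) ij.1, ι (G.t l) ij.2} : Finset (Fin q)) =
            {ι (ψ.vMap (H.s e)) (f (H.s e)), ι (ψ.vMap (H.t e)) (f (H.t e))} := by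
        intro l
        obtain ⟨e, rfl⟩ := hbij.2 l
        rcases ψ.compat_iff e with ⟨c, c'⟩ | ⟨c, c'⟩
        · refine ⟨(f (H.s e), f (H.t e)), ?_⟩
          intro e' he'
          rw [hbij.1 he', c, c']
        · refine ⟨(f (H.t e), f (H.s e)), ?_⟩
          intro e' he'
          rw [hbij.1 he', c, c', Finset.pair_comm]
      choose ε hε using hex
      refine ⟨⟨ε, ⟨fun u => ι (ψ.vMap u) (f u), ψ.eMap, fun e => hε _ e rfl⟩, ?_, hbij⟩, rfl⟩
      intro u u' h
      have := hι _ _ _ _ h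
      exact hf _ _ this.1 this.2
  calc Nat.card A = Nat.card (Set.range FA) := (Nat.card_range_of_injective hA).symm
    _ = Nat.card (Set.range FB) := by rw [hR]
    _ = Nat.card B := Nat.card_range_of_injective hB

theorem count_final (G H : MG) (hne : H.ne = G.ne) (hGni : NoIsolated G) (hHni : NoIsolated H)
    (k q : ℕ) (ι : Fin G.nv → Fin k → Fin q)
    (hι : ∀ a i b j, ι a i = ι b j → a = b ∧ i = j) (b : ℕ) (hb : H.nv + b = q) :
    (Finset.univ.filter fun ε : Fin G.ne → Fin k × Fin k =>
      MGIso (H.pad b) (tupleMG q G.ne (blow G k q ι ε) (blow_valid G k q ι hι ε))).card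
      * Nat.card {φ : MGHom H H // φ.Bij}
     = ∑ᶠ ψ : {φ : MGHom H G // φ.Surj},
          ∏ v : Fin G.nv,
            Nat.descFactorial k (Nat.card {u : Fin H.nv // ψ.1.vMap u = v}) := by
  have := Fintype.ofFinite {φ : MGHom H G // φ.Surj}
  rw [finsum_eq_sum_of_fintype]
  simp_rw [← card_fib]
  rw [← Nat.card_sigma, ← count_main G H hne hGni hHni k q ι hι, Nat.card_sigma,
    Finset.card_filter, Finset.sum_mul]
  refine Finset.sum_congr rfl fun ε _ => ?_
  split_ifs with h
  · rw [emb_card H _ hHni ((emb_iff _ _ b hb).2 h), one_mul]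
  · rw [← emb_iff _ _ b hb, not_nonempty_iff] at h
    simp

/-! ### The test functionals -/

/-- The integrand. -/
def integ (q n : ℕ) (w : Fin n → Fin q × Fin q) (g : Fin n → Kern) (x : Fin q → ℝ) : ℝ :=
  ∏ l, g l (x (w l).1) (x (w l).2)

/-- Symmetrized density functional. -/
noncomputable def Lam (q n : ℕ) (w : Fin n → Fin q × Fin q) (g : Fin n → Kern) : ℝ :=
  ∑ τ : Equiv.Perm (Fin n), ∫ x, integ q n (w ∘ τ) g x ∂(Measure.pi fun _ => μ01)

theorem integ_meas (q n : ℕ) (w : Fin n → Fin q × Fin q) (g : Fin n → Kern)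
    (hg : ∀ l, Measurable (Function.uncurry (g l))) : Measurable (integ q n w g) := by
  unfold integ
  refine Finset.measurable_prod _ fun l _ => ?_
  have h2 : Measurable fun x : Fin q → ℝ => (x (w l).1, x (w l).2) :=
    ((measurable_pi_apply (w l).1).prodMk (measurable_pi_apply (w l).2))
  exact (hg l).comp h2

theorem integ_int (q n : ℕ) (w : Fin n → Fin q × Fin q) (g : Fin n → Kern)
    (hg : ∀ l, IsKernel (g l)) :
    Integrable (integ q n w g) (Measure.pi fun _ => μ01) := by
  choose C hC using fun l => (hg l).2
  refine Integrable.of_bound (integ_meas q n w g fun l => (hg l).1.1).aestronglyMeasurable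
    (∏ l, C l) (Eventually.of_forall fun x => ?_)
  unfold integ
  rw [Real.norm_eq_abs, Finset.abs_prod]
  exact Finset.prod_le_prod (fun _ _ => abs_nonneg _) fun l _ => hC l _ _

theorem graphon_kernel {g : Kern} (h : g ∈ Graphons) : IsKernel g :=
  ⟨h.1, 1, fun x y => by
    have := h.2 x y
    rw [abs_of_nonneg this.1]; exact this.2⟩

theorem Lam_symm (q n : ℕ) (w : Fin n → Fin q × Fin q) : SymmFunc n (Lam q n w) := by
  intro g _ τ
  unfold Lam
  refine Fintype.sum_equiv (Equiv.mulRight τ⁻¹) _ _ fun ρ => ?_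
  congr 1
  funext x
  unfold integ
  refine Fintype.prod_equiv τ _ _ fun l => ?_
  simp

theorem Lam_inv (q n : ℕ) (w : Fin n → Fin q × Fin q) : SInvFunc n (Lam q n w) := by
  intro g hg σ hσ
  unfold Lam
  refine Finset.sum_congr rfl fun ρ _ => ?_
  have hmp : MeasurePreserving (fun (x : Fin q → ℝ) i => σ (x i))
      (Measure.pi fun _ => μ01) (Measure.pi fun _ => μ01) :=
    measurePreserving_pi (fun _ => μ01) (fun _ => μ01) (fun _ => hσ.1)
  have hm := integ_meas q n (w ∘ ρ) g fun l => (hg l).1.1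
  conv_rhs => rw [← hmp.map_eq]
  rw [integral_map hmp.measurable.aemeasurable hm.aestronglyMeasurable]
  rfl

theorem integ_update (q n : ℕ) (w : Fin n → Fin q × Fin q) (g : Fin n → Kern) (i : Fin n)
    (u : Kern) (x : Fin q → ℝ) :
    integ q n w (Function.update g i u) x = u (x (w i).1) (x (w i).2) *
      ∏ l ∈ Finset.univ.erase i, g l (x (w l).1) (x (w l).2) := by
  unfold integ
  rw [← Finset.mul_prod_erase _ _ (Finset.mem_univ i), Function.update_self]
  congr 1
  refine Finset.prod_congr rfl fun l hl => ?_
  rw [Function.update_of_ne (Finset.ne_of_mem_erase hl)]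

theorem update_kernel {n : ℕ} {g : Fin n → Kern} (hg : ∀ j, IsKernel (g j)) (i : Fin n)
    {u : Kern} (hu : IsKernel u) : ∀ j, IsKernel (Function.update g i u j) := by
  intro j
  by_cases h : j = i
  · subst h; rw [Function.update_self]; exact hu
  · rw [Function.update_of_ne h]; exact hg j

theorem Lam_multi (q n : ℕ) (w : Fin n → Fin q × Fin q) : MultilinearOnKerns n (Lam q n w) := by
  constructor
  · intro g hg i u v hu hv
    unfold Lam
    rw [← Finset.sum_add_distrib]
    refine Finset.sum_congr rfl fun ρ _ => ?_
    rw [← integral_add (integ_int _ _ _ _ (update_kernel hg i hu))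
      (integ_int _ _ _ _ (update_kernel hg i hv))]
    congr 1
    funext x
    simp only [integ_update, Pi.add_apply]
    ring
  · intro g hg i c u hu
    unfold Lam
    rw [Finset.mul_sum]
    refine Finset.sum_congr rfl fun ρ _ => ?_
    rw [← integral_const_mul]
    congr 1
    funext x
    simp only [integ_update, Pi.smul_apply, smul_eq_mul]
    ring

/-- Indicator of a cell. -/
noncomputable def ind (q : ℕ) (a : Fin q) (x : ℝ) : ℝ := if x ∈ cell q a then 1 else 0

theorem cell_iff (q : ℕ) (a : Fin q) (x : ℝ) : x ∈ cell q a ↔ ⌈x * q⌉ = (a : ℤ) + 1 := by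
  have hq : (0:ℝ) < q := by exact_mod_cast a.pos
  unfold cell
  rw [Set.mem_Ioc, div_lt_iff₀ hq, le_div_iff₀ hq, Int.ceil_eq_iff]
  push_cast
  simp

theorem cell_unique {q : ℕ} {a b : Fin q} {x : ℝ} (ha : x ∈ cell q a) (hb : x ∈ cell q b) :
    a = b := by
  rw [cell_iff] at ha hb
  apply Fin.ext
  omega

theorem cell_exists {q : ℕ} {x : ℝ} (hx : x ∈ Set.Ioc (0:ℝ) 1) (hq : 0 < q) :
    ∃ a, x ∈ cell q a := by
  have hq' : (0:ℝ) < q := by exact_mod_cast hq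
  have h1 : 0 < ⌈x * q⌉ := Int.ceil_pos.2 (mul_pos hx.1 hq')
  have h2 : ⌈x * q⌉ ≤ q := Int.ceil_le.2 (by
    push_cast; nlinarith [hx.2])
  refine ⟨⟨(⌈x * q⌉ - 1).toNat, by omega⟩, ?_⟩
  rw [cell_iff]
  simp only
  omega

theorem ep_eq {q : ℕ} {a b : Fin q} (h : a ≠ b) (x y : ℝ) :
    ep q a b x y = ind q a x * ind q b y + ind q b x * ind q a y := by
  unfold ep ind
  by_cases h1 : x ∈ cell q a
  · have h2 : x ∉ cell q b := fun h2 => h (cell_unique h1 h2)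
    simp [h1, h2]
  · by_cases h2 : x ∈ cell q b <;> simp [h1, h2]

theorem ind_meas (q : ℕ) (a : Fin q) : Measurable (ind q a) :=
  Measurable.ite measurableSet_Ioc measurable_const measurable_const

theorem ep_kernel {q : ℕ} {a b : Fin q} (h : a ≠ b) : IsKernel (ep q a b) := by
  refine ⟨⟨?_, ?_⟩, 1, ?_⟩
  · have : Function.uncurry (ep q a b) = fun z : ℝ × ℝ =>
        ind q a z.1 * ind q b z.2 + ind q b z.1 * ind q a z.2 := by
      funext z; exact ep_eq h _ _
    rw [this]
    have ha := ind_meas q a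
    have hb := ind_meas q b
    fun_prop
  · intro x y
    rw [ep_eq h, ep_eq h]; ring
  · intro x y
    unfold ep
    split_ifs <;> simp

/-- Sub-cell `i` of cell `a`. -/
def blk (p k : ℕ) (a : Fin p) (i : Fin k) : Fin (k * p) :=
  ⟨k * a + i, by
    have h1 := a.2
    have h2 := i.2
    calc k * a + i < k * a + k := by omega
      _ = k * (a + 1) := by ring
      _ ≤ k * p := Nat.mul_le_mul_left _ h1⟩

theorem blk_inj (p k : ℕ) (a : Fin p) (i : Fin k) (b : Fin p) (j : Fin k)
    (h : blk p k a i = blk p k b j) : a = b ∧ i = j := by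
  have h : k * (a:ℕ) + i = k * b + j := congrArg Fin.val h
  have hi := i.2
  have hj := j.2
  have h1 : (k * (a:ℕ) + i) / k = a := by
    rw [Nat.mul_add_div (by omega), Nat.div_eq_of_lt hi]; simp
  have h2 : (k * (b:ℕ) + j) / k = b := by
    rw [Nat.mul_add_div (by omega), Nat.div_eq_of_lt hj]; simp
  have h3 : (a:ℕ) = b := by rw [← h1, ← h2, h]
  rw [h3] at h
  exact ⟨Fin.ext h3, Fin.ext (by omega)⟩

theorem cell_refine (p k : ℕ) (hk : 0 < k) (a : Fin p) (x : ℝ) :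
    x ∈ cell p a ↔ ∃ i, x ∈ cell (k * p) (blk p k a i) := by
  have hk' : (0:ℝ) < k := by exact_mod_cast hk
  simp only [cell_iff, blk]
  rw [Int.ceil_eq_iff]
  push_cast
  have e1 : ((a:ℕ):ℝ) + 1 - 1 < x * p ↔ (k:ℤ) * (a:ℕ) < ⌈x * (k * p)⌉ := by
    rw [Int.lt_ceil]
    push_cast
    rw [show x * (k * p) = k * (x * p) by ring, mul_lt_mul_iff_right₀ hk']
    simp
  have e2 : x * p ≤ ((a:ℕ):ℝ) + 1 ↔ ⌈x * (k * p)⌉ ≤ (k:ℤ) * (a:ℕ) + k := by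
    rw [Int.ceil_le]
    push_cast
    rw [show x * (k * p) = k * (x * p) by ring,
      show (k:ℝ) * (a:ℕ) + k = k * ((a:ℕ) + 1) by ring, mul_le_mul_iff_right₀ hk']
  rw [e1, e2]
  generalize ⌈x * (k * p)⌉ = c
  generalize (k:ℤ) * (a:ℕ) = d
  constructor
  · rintro ⟨h1, h2⟩
    refine ⟨⟨(c - d - 1).toNat, by omega⟩, ?_⟩
    simp only
    omega
  · rintro ⟨i, hi⟩
    have := i.2
    omega

theorem ind_refine (p k : ℕ) (hk : 0 < k) (a : Fin p) (x : ℝ) :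
    ind p a x = ∑ i, ind (k * p) (blk p k a i) x := by
  unfold ind
  by_cases h : x ∈ cell p a
  · rw [if_pos h]
    obtain ⟨i, hi⟩ := (cell_refine p k hk a x).1 h
    rw [Finset.sum_eq_single i, if_pos hi]
    · intro j _ hj
      rw [if_neg]
      intro h'
      exact hj (blk_inj _ _ _ _ _ _ (cell_unique h' hi)).2
    · simp
  · rw [if_neg h, Finset.sum_eq_zero]
    intro i _
    rw [if_neg]
    intro h'
    exact h ((cell_refine p k hk a x).2 ⟨i, h'⟩)

theorem ep_refine (p k : ℕ) (hk : 0 < k) {a b : Fin p} (hab : a ≠ b) (x y : ℝ) :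
    ep p a b x y = ∑ ij : Fin k × Fin k, ep (k * p) (blk p k a ij.1) (blk p k b ij.2) x y := by
  have hne : ∀ i j, blk p k a i ≠ blk p k b j := fun i j h => hab (blk_inj _ _ _ _ _ _ h).1
  simp_rw [ep_eq hab, ep_eq (hne _ _)]
  rw [Finset.sum_add_distrib, Fintype.sum_prod_type, Fintype.sum_prod_type_right]
  simp_rw [ind_refine p k hk, Finset.sum_mul_sum]
  

/-- Graphon tuple of an index tuple. -/
noncomputable def epT (q n : ℕ) (z : Fin n → Fin q × Fin q) : Fin n → Kern := fun l => ep q (z l).1 (z l).2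

theorem Lam_refine (p k n r : ℕ) (hk : 0 < k) (w : Fin n → Fin r × Fin r)
    (x : Fin n → Fin p × Fin p) (hx : ValidTuple p n x) :
    Lam r n w (epT p n x) = ∑ ε : Fin n → Fin k × Fin k,
      Lam r n w (epT (k * p) n
        fun l => (blk p k (x l).1 (ε l).1, blk p k (x l).2 (ε l).2)) := by
  unfold Lam
  rw [Finset.sum_comm]
  refine Finset.sum_congr rfl fun ρ _ => ?_
  rw [← integral_finsetSum]
  · congr 1
    funext y
    unfold integ epT
    simp_rw [ep_refine p k hk (hx _)]
    rw [Fintype.prod_sum]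
  · intro ε _
    apply integ_int
    intro l
    exact ep_kernel fun h => hx l (blk_inj _ _ _ _ _ _ h).1

theorem ind_integral (q : ℕ) (a : Fin q) : ∫ x, ind q a x ∂μ01 = 1 / q := by
  have hq : (0:ℝ) < q := by exact_mod_cast a.pos
  have h1 : (ind q a) = (cell q a).indicator (fun _ => (1:ℝ)) := by
    funext x; simp [ind, Set.indicator]
  have hsub : cell q a ⊆ Set.Icc 0 1 := by
    intro x hx
    unfold cell at hx
    have : ((a:ℕ):ℝ) + 1 ≤ q := by exact_mod_cast a.2
    constructor
    · exact le_trans (by positivity) hx.1.le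
    · exact hx.2.trans ((div_le_one hq).2 this)
  have hm : MeasurableSet (cell q a) := measurableSet_Ioc
  rw [h1, integral_indicator hm, Measure.restrict_restrict hm,
    Set.inter_eq_left.2 hsub]
  unfold cell
  simp
  rw [← sub_div]
  simp [hq.le]

/-- Compatibility coefficient. -/
noncomputable def coef (q n : ℕ) (w z : Fin n → Fin q × Fin q) (f : Fin q → Fin q) : ℝ :=
  if ∀ l, ({f (w l).1, f (w l).2} : Finset (Fin q)) = {(z l).1, (z l).2} then 1 else 0

theorem integ_eval (q n : ℕ) (w z : Fin n → Fin q × Fin q) :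
    ∫ x, integ q n w (epT q n z) x ∂(Measure.pi fun _ => μ01)
      = ∑ f : Fin q → Fin q, coef q n w z f * (1 / q) ^ q := by
  have hae : ∀ᵐ x ∂(Measure.pi fun _ : Fin q => μ01), ∀ v, x v ∈ Set.Ioc (0:ℝ) 1 := by
    rw [ae_all_iff]
    intro v
    have : ∀ᵐ t ∂μ01, t ∈ Set.Ioc (0:ℝ) 1 := by
      have h : μ01 = volume.restrict (Set.Ioc 0 1) :=
        (Measure.restrict_congr_set Ioc_ae_eq_Icc).symm
      rw [h]
      exact ae_restrict_mem measurableSet_Ioc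
    exact (Measure.quasiMeasurePreserving_eval (fun _ : Fin q => μ01) v).ae this
  have hpt : ∀ᵐ x ∂(Measure.pi fun _ : Fin q => μ01), integ q n w (epT q n z) x
      = ∑ f : Fin q → Fin q, coef q n w z f * ∏ v, ind q (f v) (x v) := by
    filter_upwards [hae] with x hx
    have : ∀ v, ∃ a, x v ∈ cell q a := fun v => cell_exists (hx v) v.pos
    choose f0 hf0 using this
    have hiff : ∀ v a, x v ∈ cell q a ↔ f0 v = a := fun v a =>
      ⟨fun h => cell_unique (hf0 v) h, fun h => h ▸ hf0 v⟩
    rw [Finset.sum_eq_single f0]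
    · have : ∏ v, ind q (f0 v) (x v) = 1 :=
        Finset.prod_eq_one fun v _ => if_pos (hf0 v)
      rw [this, mul_one]
      unfold integ epT ep coef
      simp_rw [hiff, fpair_iff]
      rw [Finset.prod_ite_zero]
      simp
    · intro f _ hf
      obtain ⟨v, hv⟩ := Function.ne_iff.1 hf
      rw [Finset.prod_eq_zero (Finset.mem_univ v), mul_zero]
      unfold ind
      rw [if_neg]
      rw [hiff]
      exact fun h => hv h.symm
    · simp
  rw [integral_congr_ae hpt, integral_finsetSum]
  · refine Finset.sum_congr rfl fun f _ => ?_
    rw [integral_const_mul, integral_fintype_prod_eq_prod (fun v => ind q (f v))]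
    simp_rw [ind_integral]
    simp
  · intro f _
    refine Integrable.const_mul ?_ _
    refine Integrable.of_bound (C := 1) ?_ (Eventually.of_forall fun x => ?_)
    · refine Measurable.aestronglyMeasurable ?_
      exact Finset.measurable_prod _ fun v _ => (ind_meas q _).comp (measurable_pi_apply v)
    · rw [Real.norm_eq_abs, Finset.abs_prod]
      refine Finset.prod_le_one (fun _ _ => abs_nonneg _) fun v _ => ?_
      unfold ind
      split_ifs <;> simp

theorem Lam_eval (q n : ℕ) (w z : Fin n → Fin q × Fin q) :
    Lam q n w (epT q n z) = ∑ τ : Equiv.Perm (Fin n), ∑ f : Fin q → Fin q,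
      coef q n (w ∘ τ) z f * (1 / q) ^ q := by
  unfold Lam
  simp_rw [integ_eval]

theorem coef_iso {q n : ℕ} (w z z' : Fin n → Fin q × Fin q)
    (φv : Equiv.Perm (Fin q)) (φe : Equiv.Perm (Fin n))
    (h : ∀ l, ({(z' (φe l)).1, (z' (φe l)).2} : Finset (Fin q)) = {φv (z l).1, φv (z l).2})
    (τ : Equiv.Perm (Fin n)) (f : Fin q → Fin q) :
    coef q n (w ∘ τ) z f = coef q n (w ∘ ⇑(τ * φe⁻¹)) z' (φv ∘ f) := by
  unfold coef
  congr 1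
  rw [eq_iff_iff]
  refine (Equiv.forall_congr φe ?_)
  intro l
  rw [h]
  simp [fpair_iff]

theorem Lam_iso {q n : ℕ} (w z z' : Fin n → Fin q × Fin q) (hz : ValidTuple q n z)
    (hz' : ValidTuple q n z') (h : MGIso (tupleMG q n z hz) (tupleMG q n z' hz')) :
    Lam q n w (epT q n z) = Lam q n w (epT q n z') := by
  obtain ⟨φ, h1, h2⟩ := h
  let φv : Equiv.Perm (Fin q) := Equiv.ofBijective φ.vMap h1
  let φe : Equiv.Perm (Fin n) := Equiv.ofBijective φ.eMap h2
  rw [Lam_eval, Lam_eval]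
  refine Fintype.sum_equiv (Equiv.mulRight φe⁻¹) _ _ fun τ => ?_
  refine Fintype.sum_equiv (Equiv.arrowCongr (Equiv.refl _) φv) _ _ fun f => ?_
  rw [coef_iso w z z' φv φe (fun l => φ.compat l)]
  rfl

theorem Lam_self {q n : ℕ} (hq : 0 < q) (w : Fin n → Fin q × Fin q) :
    Lam q n w (epT q n w) ≠ 0 := by
  have hc : ∀ (τ : Equiv.Perm (Fin n)) f, 0 ≤ coef q n (w ∘ τ) w f * (1 / (q:ℝ)) ^ q := by
    intro τ f
    refine mul_nonneg ?_ (by positivity)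
    unfold coef
    split_ifs <;> norm_num
  rw [Lam_eval]
  apply ne_of_gt
  refine Finset.sum_pos' (fun τ _ => Finset.sum_nonneg fun f _ => hc τ f)
    ⟨1, Finset.mem_univ _, Finset.sum_pos' (fun f _ => hc 1 f) ⟨id, Finset.mem_univ _, ?_⟩⟩
  have hq' : (0:ℝ) < q := by exact_mod_cast hq
  have : coef q n (w ∘ (1 : Equiv.Perm (Fin n))) w id = 1 := by
    unfold coef
    rw [if_pos]
    intro l; rfl
  rw [this]
  positivity

theorem Lam_ne_zero {q n : ℕ} (w z : Fin n → Fin q × Fin q) (hw : ValidTuple q n w)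
    (hz : ValidTuple q n z) (h : Lam q n w (epT q n z) ≠ 0) :
    ∃ φ : MGHom (tupleMG q n w hw) (tupleMG q n z hz), Function.Bijective φ.eMap := by
  rw [Lam_eval] at h
  obtain ⟨τ, _, h⟩ := Finset.exists_ne_zero_of_sum_ne_zero h
  obtain ⟨f, _, h⟩ := Finset.exists_ne_zero_of_sum_ne_zero h
  have h := left_ne_zero_of_mul h
  unfold coef at h
  have h' : ∀ l, ({f ((w ∘ τ) l).1, f ((w ∘ τ) l).2} : Finset (Fin q)) = {(z l).1, (z l).2} := by
    by_contra hc
    exact h (if_neg hc)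
  refine ⟨⟨f, τ.symm, ?_⟩, τ.symm.bijective⟩
  intro (e : Fin n)
  have := h' (τ.symm e)
  simp only [Function.comp, Equiv.apply_symm_apply] at this
  exact this.symm

theorem triangular (q n m : ℕ) (hq : 0 < q) (y : Fin m → Fin n → Fin q × Fin q)
    (hy : ∀ i, ValidTuple q n (y i))
    (hni : ∀ i j, i ≠ j → ¬ MGIso (tupleMG q n (y i) (hy i)) (tupleMG q n (y j) (hy j)))
    (d : Fin m → ℝ) (hd : ∀ j, ∑ i, d i * Lam q n (y j) (epT q n (y i)) = 0) :
    ∀ i, d i = 0 := by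
  have key : ∀ c i, (tupleMG q n (y i) (hy i)).supp.card = c → d i = 0 := by
    intro c
    induction c using Nat.strong_induction_on with
    | _ c ih =>
      intro i hi
      have h := hd i
      rw [Finset.sum_eq_single i] at h
      · exact (mul_eq_zero.1 h).resolve_right (Lam_self hq (y i))
      · intro j _ hj
        by_cases hL : Lam q n (y i) (epT q n (y j)) = 0
        · rw [hL, mul_zero]
        obtain ⟨φ, hφ⟩ := Lam_ne_zero _ _ (hy i) (hy j) hL
        have hle : (tupleMG q n (y j) (hy j)).supp.card < c := by
          rw [← hi]
          by_contra hc
          exact hni i j (Ne.symm hj) (φ.iso_of_card hφ rfl (not_lt.1 hc))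
        rw [ih _ hle j rfl, zero_mul]
      · simp
  exact fun i => key _ i rfl

theorem determined (n k p : ℕ) (hk : 1 ≤ k) (hp : 2 ≤ p) (π : MG → MG → ℕ)
    (hπ : ConsistencyMatrix n k π) (x : Fin n → Fin p × Fin p) (hx : ValidTuple p n x)
    (hv : ∀ ε : Fin n → Fin k × Fin k, ValidTuple (k * p) n
      fun l => (blk p k (x l).1 (ε l).1, blk p k (x l).2 (ε l).2))
    (z : Fin n → Fin (k * p) × Fin (k * p)) (hz : ValidTuple (k * p) n z) :
    ∃ (y : Fin n → Fin (k * p) × Fin (k * p)) (hy : ValidTuple (k * p) n y),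
      MGIso (tupleMG (k * p) n z hz) (tupleMG (k * p) n y hy) ∧
      π (tupleMG p n x hx) (tupleMG (k * p) n y hy) =
        (Finset.univ.filter fun ε : Fin n → Fin k × Fin k =>
          MGIso (tupleMG (k * p) n y hy) (tupleMG (k * p) n _ (hv ε))).card := by
  have hq : 0 < k * p := Nat.mul_pos (by omega) (by omega)
  let T := {z : Fin n → Fin (k * p) × Fin (k * p) // ValidTuple (k * p) n z}
  let st : Setoid T :=
    { r := fun a b => MGIso (tupleMG (k * p) n a.1 a.2) (tupleMG (k * p) n b.1 b.2)
      iseqv := ⟨fun _ => MGIso.refl' _, fun h => h.symm', fun h h' => h.trans' h'⟩ }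
  obtain ⟨m, ⟨e⟩⟩ := Finite.exists_equiv_fin (Quotient st)
  let yy : Fin m → T := fun i => (e.symm i).out
  let y : Fin m → Fin n → Fin (k * p) × Fin (k * p) := fun i => (yy i).1
  have hy : ∀ i, ValidTuple (k * p) n (y i) := fun i => (yy i).2
  have hni : ∀ i j, i ≠ j →
      ¬ MGIso (tupleMG (k*p) n (y i) (hy i)) (tupleMG (k*p) n (y j) (hy j)) := by
    intro i j hij h
    apply hij
    have h' : (Quotient.mk st (yy i)) = Quotient.mk st (yy j) := Quotient.sound h
    simp only [yy, Quotient.out_eq] at h'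
    exact e.symm.injective h'
  have hex : ∀ (z : Fin n → Fin (k*p) × Fin (k*p)) (hz : ValidTuple (k*p) n z),
        ∃ i, MGIso (tupleMG (k*p) n z hz) (tupleMG (k*p) n (y i) (hy i)) := by
    intro z hz
    refine ⟨e (Quotient.mk st ⟨z, hz⟩), ?_⟩
    have : st.r ((e.symm (e (Quotient.mk st ⟨z, hz⟩))).out) ⟨z, hz⟩ := by
      rw [Equiv.symm_apply_apply]
      exact Quotient.mk_out (s := st) ⟨z, hz⟩
    exact MGIso.symm' this
  let M : Fin m → ℕ := fun i => (Finset.univ.filter fun ε : Fin n → Fin k × Fin k =>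
          MGIso (tupleMG (k * p) n (y i) (hy i)) (tupleMG (k * p) n _ (hv ε))).card
  have hall : ∀ i, ((π (tupleMG p n x hx) (tupleMG (k * p) n (y i) (hy i)) : ℝ) - M i) = 0 := by
    apply triangular (k * p) n m hq y hy hni
    intro j
    have h1 := hπ.2 p hp (Lam (k * p) n (y j)) (Lam_symm _ _ _) (Lam_inv _ _ _)
      (Lam_multi _ _ _) x hx m y hy hni hex
    have h2 := Lam_refine p k n (k * p) hk (y j) x hx
    have h3 : ∑ i, (M i : ℝ) * Lam (k * p) n (y j) (epT (k * p) n (y i)) =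
        ∑ ε : Fin n → Fin k × Fin k, Lam (k * p) n (y j) (epT (k * p) n
          fun l => (blk p k (x l).1 (ε l).1, blk p k (x l).2 (ε l).2)) := by
      simp only [M, Finset.card_filter]
      push_cast
      simp_rw [Finset.sum_mul]
      rw [Finset.sum_comm]
      refine Finset.sum_congr rfl fun ε _ => ?_
      obtain ⟨i, hi⟩ := hex _ (hv ε)
      rw [Finset.sum_eq_single i, if_pos hi.symm', one_mul]
      · exact (Lam_iso _ _ _ _ _ hi).symm
      · intro j _ hj
        rw [if_neg, zero_mul]
        intro h
        exact hni _ _ hj (h.trans' hi)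
      · simp
    simp_rw [sub_mul]
    rw [Finset.sum_sub_distrib, h3, ← h2]
    exact sub_eq_zero.2 h1.symm
  obtain ⟨i, hi⟩ := hex z hz
  refine ⟨y i, hy i, hi, ?_⟩
  have := sub_eq_zero.1 (hall i)
  exact_mod_cast this

/-- The entries of the consistency matrix `π_{n,k}` are given, for
multigraphs `G, H` with `n` edges and no isolated vertices, by
`π_{n,k}([G],[H]) · |Aut(H)| = Σ_{ψ : H ↠ G} Π_{v ∈ V(G)} k(k-1)⋯(k-|ψ⁻¹(v)|+1)`. -/
theorem stmt10 (n k : ℕ) (hn : 1 ≤ n) (hk : 1 ≤ k)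
    (π : MG → MG → ℕ) (hπ : ConsistencyMatrix n k π)
    (G H : MG) (hG : G.ne = n) (hH : H.ne = n)
    (hGni : NoIsolated G) (hHni : NoIsolated H) :
    π G H * Nat.card {φ : MGHom H H // φ.Bij}
      = ∑ᶠ ψ : {φ : MGHom H G // φ.Surj},
          ∏ v : Fin G.nv,
            Nat.descFactorial k (Nat.card {u : Fin H.nv // ψ.1.vMap u = v}) := by
  subst hG
  set a := H.nv with ha
  set p := G.nv + a with hp
  have hnv : 2 ≤ G.nv := by
    have h1 := (G.s ⟨0, hn⟩).2
    have h2 := (G.t ⟨0, hn⟩).2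
    have h3 := G.noLoop ⟨0, hn⟩
    have h4 : (G.s ⟨0, hn⟩ : ℕ) ≠ G.t ⟨0, hn⟩ := fun h => h3 (Fin.ext h)
    omega
  have hle : H.nv ≤ k * p := by
    have : 1 * p ≤ k * p := Nat.mul_le_mul_right _ hk
    omega
  obtain ⟨b, hb⟩ := Nat.exists_eq_add_of_le hle
  let x : Fin G.ne → Fin p × Fin p := fun l => (Fin.castAdd a (G.s l), Fin.castAdd a (G.t l))
  have hx : ValidTuple p G.ne x := (G.pad a).noLoop
  let ι : Fin G.nv → Fin k → Fin (k * p) := fun u i => blk p k (Fin.castAdd a u) i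
  have hι : ∀ a i b j, ι a i = ι b j → a = b ∧ i = j := by
    intro u i v j h
    have := blk_inj _ _ _ _ _ _ h
    exact ⟨Fin.castAdd_injective _ _ this.1, this.2⟩
  have hv := blow_valid G k (k * p) ι hι
  let cst : Fin (H.nv + b) → Fin (k * p) := Fin.cast hb.symm
  let ce : Fin G.ne → Fin H.ne := Fin.cast hH.symm
  let z : Fin G.ne → Fin (k * p) × Fin (k * p) := fun l =>
    (cst ((H.pad b).s (ce l)), cst ((H.pad b).t (ce l)))
  have hz : ValidTuple (k * p) G.ne z := by
    intro l h
    exact (H.pad b).noLoop (ce l) (Fin.cast_injective hb.symm h)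
  have hzi : MGIso (tupleMG (k * p) G.ne z hz) (H.pad b) := by
    refine ⟨⟨Fin.cast hb, ce, fun e => rfl⟩, ?_, ?_⟩
    · exact (finCongr hb).bijective
    · exact (finCongr hH.symm).bijective
  obtain ⟨y, hy, hyi, hyc⟩ := determined G.ne k p hk (by omega) π hπ x hx hv z hz
  have hHy : MGIso (H.pad b) (tupleMG (k * p) G.ne y hy) := hzi.symm'.trans' hyi
  have hpi : π G H = π (tupleMG p G.ne x hx) (tupleMG (k * p) G.ne y hy) := by
    apply hπ.1
    · exact ⟨a, 0, MGIso.pad0 (G.pad a)⟩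
    · exact ⟨b, 0, hHy.trans' (MGIso.pad0 _)⟩
  rw [hpi, hyc, ← count_final G H hH hGni hHni k (k * p) ι hι b hb.symm]
  congr 2
  ext ε
  simp only [Finset.mem_filter, Finset.mem_univ, true_and]
  exact ⟨fun h => hHy.trans' h, fun h => hHy.symm'.trans' h⟩
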